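/- arXiv:cs/0205031 — 8 statements merged into one kernel-verified Lean document; each statement's English description precedes it below -/
import Mathlib

section
/- Farkas' Lemma: Let A be a real n×m matrix and b a real n-vector. The system of linear inequalities ∑_{j=1}^m A_{ij} x_j ≤ b_i for all i = 1,…,n has a solution x ∈ ℝ^m if and only if there is no vector λ ∈ ℝ^n with λ_i ≥ 0 for all i, ∑_{i=1}^n λ_i A_{ij} = 0 for all j = 1,…,m, and ∑_{i=1}^n λ_i b_i < 0. -/
/-- One-variable case of Farkas' lemma: every lower bound is below every upper bound. -/
theorem exists_forall_mul_le_of_pairwise {ι : Type*} [Fintype ι] (a r : ι → ℝ)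
    (hzero : ∀ i, a i = 0 → 0 ≤ r i)
    (hpair : ∀ i j, 0 < a i → a j < 0 → 0 ≤ -a j * r i + a i * r j) :
    ∃ x, ∀ i, a i * x ≤ r i := by
  classical
  by_cases hneg : ∃ j, a j < 0
  · obtain ⟨j, hj, hmax⟩ := (Finset.univ.filter fun j => a j < 0).exists_max_image
      (fun j => r j / a j) (by simpa [Finset.Nonempty] using hneg)
    simp only [Finset.mem_filter, Finset.mem_univ, true_and] at hj hmax
    refine ⟨r j / a j, fun i => ?_⟩
    rcases lt_trichotomy (a i) 0 with hi | hi | hi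
    · have := hmax i hi
      rw [div_le_iff_of_neg hi] at this
      linarith
    · simpa [hi] using hzero i hi
    · rw [← mul_div_assoc, div_le_iff_of_neg hj]
      linarith [hpair i j hi hj]
  · push Not at hneg
    obtain ⟨x, hx⟩ := (Finset.univ.image fun i => r i / a i).bddBelow
    refine ⟨x, fun i => ?_⟩
    rcases (hneg i).eq_or_lt with hi | hi
    · simpa [← hi] using hzero i hi.symm
    · have := hx (Finset.mem_coe.2 <| Finset.mem_image_of_mem _ (Finset.mem_univ i))
      rw [le_div_iff₀ hi] at this
      linarith

/-- The weights of Fourier–Motzkin elimination: the nonnegative combination of rows attached to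
the pair `(i, j)`, which cancels the coefficients `a` of the eliminated variable. -/
noncomputable def eliminationWeight {ι : Type*} [DecidableEq ι] (a : ι → ℝ) (p : ι × ι) : ι → ℝ :=
  if a p.1 = 0 then Pi.single p.1 1
  else if 0 < a p.1 ∧ a p.2 < 0 then Pi.single p.1 (-a p.2) + Pi.single p.2 (a p.1)
  else 0

theorem eliminationWeight_nonneg {ι : Type*} [DecidableEq ι] (a : ι → ℝ) (p : ι × ι) :
    0 ≤ eliminationWeight a p := by
  unfold eliminationWeight
  split_ifs with h₁ h₂
  · exact Pi.single_nonneg.2 zero_le_one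
  · exact add_nonneg (Pi.single_nonneg.2 (by linarith)) (Pi.single_nonneg.2 h₂.1.le)
  · exact le_rfl

theorem sum_eliminationWeight_mul_self {ι : Type*} [Fintype ι] [DecidableEq ι] (a : ι → ℝ)
    (p : ι × ι) : ∑ k, eliminationWeight a p k * a k = 0 := by
  unfold eliminationWeight
  split_ifs with h₁ h₂
  · simp [Pi.single_apply, h₁]
  · simp [Pi.single_apply, add_mul, Finset.sum_add_distrib]
    ring
  · simp

theorem exists_forall_mul_le_of_eliminationWeight {ι : Type*} [Fintype ι] [DecidableEq ι]
    (a r : ι → ℝ) (h : ∀ p, 0 ≤ ∑ k, eliminationWeight a p k * r k) :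
    ∃ x, ∀ i, a i * x ≤ r i := by
  refine exists_forall_mul_le_of_pairwise a r (fun i hi => ?_) fun i j hi hj => ?_
  · simpa [eliminationWeight, hi, Pi.single_apply] using h (i, i)
  · simpa [eliminationWeight, hi, hj, hi.ne', Pi.single_apply, add_mul,
      Finset.sum_add_distrib] using h (i, j)

/-- The nontrivial direction of Farkas' lemma, for an arbitrary finite family of inequalities. -/
theorem exists_solution_of_forall_certificate_nonneg (m : ℕ) {ι : Type*} [Fintype ι]
    (A : ι → Fin m → ℝ) (b : ι → ℝ)
    (h : ∀ l : ι → ℝ, (∀ i, 0 ≤ l i) → (∀ j, ∑ i, l i * A i j = 0) → 0 ≤ ∑ i, l i * b i) :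
    ∃ x : Fin m → ℝ, ∀ i, ∑ j, A i j * x j ≤ b i := by
  classical
  induction m generalizing ι with
  | zero =>
    refine ⟨0, fun i => ?_⟩
    simpa [Pi.single_apply] using
      h (Pi.single i 1)
        (fun k => (Pi.single_nonneg.2 zero_le_one : (0 : ι → ℝ) ≤ Pi.single i 1) k)
        fun j => j.elim0
  | succ m ih =>
    set w := eliminationWeight fun i => A i 0
    have pull (l : ι × ι → ℝ) (c : ι → ℝ) :
        ∑ k, (∑ p, l p * w p k) * c k = ∑ p, l p * ∑ k, w p k * c k := by
      simp only [Finset.sum_mul, Finset.mul_sum, mul_assoc]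
      exact Finset.sum_comm
    obtain ⟨y, hy⟩ := ih (fun p j => ∑ k, w p k * A k j.succ) (fun p => ∑ k, w p k * b k) <| by
      intro l hl hlA
      rw [← pull]
      refine h _ (fun k => Finset.sum_nonneg fun p _ =>
        mul_nonneg (hl p) (eliminationWeight_nonneg _ p k)) fun j => ?_
      rw [pull]
      refine Fin.cases ?_ hlA j
      exact Finset.sum_eq_zero fun p _ =>
        mul_eq_zero_of_right _ (sum_eliminationWeight_mul_self (fun i => A i 0) p)
    obtain ⟨t, ht⟩ := exists_forall_mul_le_of_eliminationWeight (fun i => A i 0)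
      (fun i => b i - ∑ j, A i (Fin.succ j) * y j) <| by
        intro p
        have hswap : ∑ k, w p k * ∑ j, A k (Fin.succ j) * y j =
            ∑ j, (∑ k, w p k * A k (Fin.succ j)) * y j := by
          simp only [Finset.sum_mul, Finset.mul_sum, mul_assoc]
          exact Finset.sum_comm
        simp only [mul_sub, Finset.sum_sub_distrib]
        exact sub_nonneg.2 (hswap.trans_le (hy p))
    refine ⟨Fin.cons t y, fun i => ?_⟩
    simpa [Fin.sum_univ_succ] using le_sub_iff_add_le.1 (ht i)

/-- **Farkas' Lemma.** The system `∑ j, A i j * x j ≤ b i` (for all `i`) has a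
solution `x` iff there is no `λ ≥ 0` with `∑ i, λ i * A i j = 0` for all `j`
and `∑ i, λ i * b i < 0`. -/
theorem farkas_lemma (n m : ℕ) (A : Matrix (Fin n) (Fin m) ℝ) (b : Fin n → ℝ) :
    (∃ x : Fin m → ℝ, ∀ i, ∑ j, A i j * x j ≤ b i) ↔
      ¬ ∃ l : Fin n → ℝ, (∀ i, 0 ≤ l i) ∧ (∀ j, ∑ i, l i * A i j = 0) ∧
        ∑ i, l i * b i < 0 := by
  constructor
  · rintro ⟨x, hx⟩ ⟨l, hl, hlA, hlb⟩
    refine hlb.not_ge ?_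
    calc 0 = ∑ j, (∑ i, l i * A i j) * x j := by simp [hlA]
      _ = ∑ i, l i * ∑ j, A i j * x j := by
        simp only [Finset.sum_mul, Finset.mul_sum, mul_assoc]
        exact Finset.sum_comm
      _ ≤ ∑ i, l i * b i :=
        Finset.sum_le_sum fun i _ => mul_le_mul_of_nonneg_left (hx i) (hl i)
  · intro h
    push Not at h
    exact exists_solution_of_forall_certificate_nonneg m A b h
end

section
/- (Separation of a point from a finitely generated cone.) Let v_1, …, v_n be vectors in ℝ^m and let y ∈ ℝ^m. If y does not lie in the convex cone generated by v_1, …, v_n, i.e. there are no coefficients c_1, …, c_n ≥ 0 with y = ∑_{i=1}^n c_i v_i, then there exists a vector h ∈ ℝ^m such that ⟨h, y⟩ < 0 and ⟨h, v_i⟩ ≥ 0 for every i = 1, …, n. -/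
open scoped RealInnerProductSpace

/-- **The Farkas lemma** in a real inner product space, proved by induction on the number of
generators: if a vector `h` separating `y` from the last `n` generators fails at `v 0`, project along
`v 0` onto the orthogonal complement of `h`. -/
theorem exists_inner_neg_of_not_nonneg_combination {E : Type*} [NormedAddCommGroup E]
    [InnerProductSpace ℝ E] (n : ℕ) (v : Fin n → E) (y : E)
    (hy : ¬ ∃ c : Fin n → ℝ, (∀ i, 0 ≤ c i) ∧ y = ∑ i, c i • v i) :
    ∃ h : E, ⟪h, y⟫ < 0 ∧ ∀ i, 0 ≤ ⟪h, v i⟫ := by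
  induction n generalizing y with
  | zero =>
    have hy0 : y ≠ 0 := fun h0 => hy ⟨0, by simp, by simp [h0]⟩
    exact ⟨-y, by simpa only [inner_neg_left, neg_lt_zero, real_inner_self_pos] using hy0,
      fun i => i.elim0⟩
  | succ n ih =>
    obtain ⟨h, hhy, hhv⟩ := ih (fun i => v i.succ) y (by
      rintro ⟨c, hc, rfl⟩
      exact hy ⟨Fin.cons 0 c, Fin.cases (by simp) (by simpa using hc),
        by simp [Fin.sum_univ_succ]⟩)
    by_cases h0 : 0 ≤ ⟪h, v 0⟫
    · exact ⟨h, hhy, Fin.cases h0 hhv⟩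
    push Not at h0
    let proj : E → E := fun x => x - (⟪h, x⟫ / ⟪h, v 0⟫) • v 0
    obtain ⟨g, hgy, hgv⟩ := ih (fun i => proj (v i.succ)) (proj y) (by
      rintro ⟨c, hc, hyc⟩
      refine hy ⟨Fin.cons (⟪h, y⟫ / ⟪h, v 0⟫ - ∑ i, c i * (⟪h, v i.succ⟫ / ⟪h, v 0⟫)) c,
        Fin.cases ?nonneg (by simpa using hc), ?eq⟩
      case nonneg =>
        have hnonpos : ∑ i, c i * (⟪h, v i.succ⟫ / ⟪h, v 0⟫) ≤ 0 :=
          Finset.sum_nonpos fun i _ => mul_nonpos_of_nonneg_of_nonpos (hc i)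
            (div_nonpos_of_nonneg_of_nonpos (hhv i) h0.le)
        have hpos : 0 < ⟪h, y⟫ / ⟪h, v 0⟫ := div_pos_of_neg_of_neg hhy h0
        simp only [Fin.cons_zero]
        linarith
      case eq =>
        simp only [proj, smul_sub, Finset.sum_sub_distrib, smul_smul, ← Finset.sum_smul] at hyc
        simp only [Fin.sum_univ_succ, Fin.cons_zero, Fin.cons_succ, sub_smul]
        exact (sub_eq_iff_eq_add.mp hyc).trans (by abel))
    have inner_adjoint (x : E) : ⟪g - (⟪g, v 0⟫ / ⟪h, v 0⟫) • h, x⟫ = ⟪g, proj x⟫ := by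
      simp only [proj, inner_sub_left, inner_sub_right, real_inner_smul_left,
        real_inner_smul_right]
      ring
    refine ⟨g - (⟪g, v 0⟫ / ⟪h, v 0⟫) • h, by rwa [inner_adjoint], Fin.cases ?_ fun i => ?_⟩
    · simp [inner_adjoint, proj, div_self h0.ne]
    · rw [inner_adjoint]
      exact hgv i

/-- **Separation of a point from a finitely generated cone.** If `y` is not a
nonnegative linear combination of `v 1, …, v n`, then there is a vector `h`
with `⟪h, y⟫ < 0` and `⟪h, v i⟫ ≥ 0` for every `i`. -/
theorem separation_from_finitely_generated_cone (n m : ℕ)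
    (v : Fin n → EuclideanSpace ℝ (Fin m)) (y : EuclideanSpace ℝ (Fin m))
    (hy : ¬ ∃ c : Fin n → ℝ, (∀ i, 0 ≤ c i) ∧ y = ∑ i, c i • v i) :
    ∃ h : EuclideanSpace ℝ (Fin m), ⟪h, y⟫ < 0 ∧ ∀ i, 0 ≤ ⟪h, v i⟫ := by
  exact exists_inner_neg_of_not_nonneg_combination n v y hy
end

section
/- (Farkas-type alternative used in the proof of the min-max theorem.) Let M be a real n×m matrix and t ∈ ℝ. If there is no vector q ∈ ℝ^n with q_r ≥ 0 for all r, ∑_{r=1}^n q_r = 1, and ∑_{r=1}^n q_r M_{ri} ≥ t for every i = 1,…,m, then there exist λ ∈ ℝ^m with λ_i ≥ 0, μ ∈ ℝ^n with μ_j ≥ 0, and α ∈ ℝ such that ∑_{i=1}^m M_{ji} λ_i + μ_j + α = 0 for every j = 1,…,n, and t·(∑_{i=1}^m λ_i) + α > 0. -/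
/-- **Farkas-type alternative used in the proof of the min-max theorem.** If
there is no probability vector `q` over rows with `∑ r, q r * M r i ≥ t` for
every column `i`, then there exist `λ ≥ 0`, `μ ≥ 0` and `α ∈ ℝ` with
`∑ i, M j i * λ i + μ j + α = 0` for every row `j` and
`t * (∑ i, λ i) + α > 0`. -/
theorem farkas_alternative_minmax (n m : ℕ) (M : Matrix (Fin n) (Fin m) ℝ) (t : ℝ)
    (hq : ¬ ∃ q : Fin n → ℝ, (∀ r, 0 ≤ q r) ∧ (∑ r, q r = 1) ∧
      ∀ i, t ≤ ∑ r, q r * M r i) :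
    ∃ (l : Fin m → ℝ) (μ : Fin n → ℝ) (α : ℝ),
      (∀ i, 0 ≤ l i) ∧ (∀ j, 0 ≤ μ j) ∧
      (∀ j, ∑ i, M j i * l i + μ j + α = 0) ∧
      0 < t * (∑ i, l i) + α := by
  obtain ⟨f, u, v, hu, huv, hv⟩ := geometric_hahn_banach_compact_closed
    (s := Matrix.vecMulLinear M '' stdSimplex ℝ (Fin n)) (t := Set.Ici fun _ => t)
    ((convex_stdSimplex ℝ (Fin n)).linear_image _)
    ((isCompact_stdSimplex ℝ (Fin n)).image (LinearMap.continuous_of_finiteDimensional _))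
    (convex_Ici _) isClosed_Ici (by
      rw [Set.disjoint_left]
      rintro _ ⟨q, hq', rfl⟩ hge
      exact hq ⟨q, hq'.1, hq'.2, hge⟩)
  have hf : ∀ x : Fin m → ℝ, f x = ∑ i, x i * f (Pi.single i 1) := by
    intro x
    conv_lhs => rw [pi_eq_sum_univ' x]
    simp [map_sum, Pi.single]
  have hrow : ∀ j, f (M j) < u := fun j =>
    hu _ ⟨Pi.single j 1, single_mem_stdSimplex ℝ j, by simp [Matrix.row]⟩
  have hconst : v < f fun _ => t := hv _ Set.self_mem_Ici
  refine ⟨fun i => f (Pi.single i 1), fun j => u - f (M j), -u, fun i => ?_,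
    fun j => by linarith [hrow j], fun j => ?_, ?_⟩
  · by_contra! hneg
    obtain ⟨k, hk⟩ := exists_nat_gt ((v - f fun _ => t) / f (Pi.single i 1))
    have hmem : (fun _ => t) + (k : ℝ) • Pi.single i (1 : ℝ) ∈ Set.Ici fun _ : Fin m => t := by
      refine Set.mem_Ici.2 (le_add_of_nonneg_right (smul_nonneg k.cast_nonneg ?_))
      exact Pi.single_nonneg.2 zero_le_one
    have hlt := hv _ hmem
    rw [map_add, map_smul, smul_eq_mul] at hlt
    rw [div_lt_iff_of_neg hneg] at hk
    linarith
  · have hj := hf (M j)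
    beta_reduce
    linarith
  · rw [hf, ← Finset.mul_sum] at hconst
    linarith
end

section
/- (Von Neumann's min-max theorem.) Let M be a real n×m matrix, defining a zero-sum game in which the row player chooses a probability distribution q over the n rows, the column player chooses a probability distribution p over the m columns, and the payoff is qᵀMp = ∑_{i,j} q_i M_{ij} p_j. Then the infimum over probability vectors p of the supremum over probability vectors q of qᵀMp equals the supremum over probability vectors q of the infimum over probability vectors p of qᵀMp. -/
/-- A saddle point of a real-valued function all of whose partial functions are bounded on the
relevant side gives the equality of the infimum of suprema and the supremum of infima. -/
theorem ciInf_ciSup_eq_ciSup_ciInf_of_saddlePoint {α β : Type*} {f : α → β → ℝ} {a : α} {b : β}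
    (h : ∀ x y, f a y ≤ f x b) (hsup : ∀ x, BddAbove (Set.range (f x)))
    (hinf : ∀ y, BddBelow (Set.range fun x => f x y)) :
    ⨅ x, ⨆ y, f x y = ⨆ y, ⨅ x, f x y := by
  have : Nonempty α := ⟨a⟩
  have : Nonempty β := ⟨b⟩
  have hle (x : α) : f a b ≤ ⨆ y, f x y := (h x b).trans (le_ciSup (hsup x) b)
  have hge (y : β) : ⨅ x, f x y ≤ f a b := (ciInf_le (hinf y) a).trans (h a y)
  have hbelow : BddBelow (Set.range fun x => ⨆ y, f x y) :=
    ⟨f a b, by rintro _ ⟨x, rfl⟩; exact hle x⟩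
  have habove : BddAbove (Set.range fun y => ⨅ x, f x y) :=
    ⟨f a b, by rintro _ ⟨y, rfl⟩; exact hge y⟩
  apply le_antisymm
  · calc ⨅ x, ⨆ y, f x y ≤ ⨆ y, f a y := ciInf_le hbelow a
      _ ≤ f a b := ciSup_le (h a)
      _ ≤ ⨅ x, f x b := le_ciInf fun x => h x b
      _ ≤ ⨆ y, ⨅ x, f x y := le_ciSup habove b
  · exact (ciSup_le hge).trans (le_ciInf hle)

/-- The minimax theorem for a bilinear form on two nonempty compact convex sets. -/
theorem LinearMap.ciInf_ciSup_eq_ciSup_ciInf {E F : Type*}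
    [TopologicalSpace E] [AddCommGroup E] [Module ℝ E] [IsTopologicalAddGroup E]
    [ContinuousSMul ℝ E] [TopologicalSpace F] [AddCommGroup F] [Module ℝ F]
    [IsTopologicalAddGroup F] [ContinuousSMul ℝ F]
    (B : E →ₗ[ℝ] F →ₗ[ℝ] ℝ) {X : Set E} {Y : Set F}
    (neX : X.Nonempty) (cX : Convex ℝ X) (kX : IsCompact X)
    (neY : Y.Nonempty) (cY : Convex ℝ Y) (kY : IsCompact Y)
    (hB₁ : ∀ x, Continuous (B x)) (hB₂ : ∀ y, Continuous (B.flip y)) :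
    ⨅ x : X, ⨆ y : Y, B x y = ⨆ y : Y, ⨅ x : X, B x y := by
  obtain ⟨a, ha, b, hb, hab⟩ := Sion.exists_isSaddlePointOn (f := fun x y => B x y) neX cX kX
    (fun y _ => (hB₂ y).lowerSemicontinuous.lowerSemicontinuousOn _)
    (fun y _ => ((B.flip y).convexOn cX).quasiconvexOn) cY neY kY
    (fun x _ => (hB₁ x).upperSemicontinuous.upperSemicontinuousOn _)
    (fun x _ => ((B x).concaveOn cY).quasiconcaveOn)
  have : CompactSpace X := isCompact_iff_compactSpace.mp kX
  have : CompactSpace Y := isCompact_iff_compactSpace.mp kY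
  exact ciInf_ciSup_eq_ciSup_ciInf_of_saddlePoint (f := fun (x : X) (y : Y) => B x y)
    (a := ⟨a, ha⟩) (b := ⟨b, hb⟩) (fun x y => hab x x.2 y y.2)
    (fun x => (isCompact_range ((hB₁ x).comp continuous_subtype_val)).bddAbove)
    (fun y => (isCompact_range ((hB₂ y).comp continuous_subtype_val)).bddBelow)

/-- **Von Neumann's min-max theorem.** For a zero-sum game given by a matrix
`M`, the infimum over mixed column strategies `p` of the supremum over mixed
row strategies `q` of the payoff `qᵀMp` equals the supremum over `q` of the
infimum over `p` of the payoff. -/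
theorem von_neumann_minmax (n m : ℕ) (M : Matrix (Fin n) (Fin m) ℝ) :
    (⨅ p : stdSimplex ℝ (Fin m), ⨆ q : stdSimplex ℝ (Fin n),
        ∑ i, ∑ j, q.1 i * M i j * p.1 j) =
      ⨆ q : stdSimplex ℝ (Fin n), ⨅ p : stdSimplex ℝ (Fin m),
        ∑ i, ∑ j, q.1 i * M i j * p.1 j := by
  rcases isEmpty_or_nonempty (Fin n) with hn | hn
  · simp
  rcases isEmpty_or_nonempty (Fin m) with hm | hm
  · simp
  have h := LinearMap.ciInf_ciSup_eq_ciSup_ciInf (Matrix.toLinearMap₂' ℝ M).flip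
    (Set.nonempty_coe_sort.mp inferInstance) (convex_stdSimplex ℝ (Fin m))
    (isCompact_stdSimplex ℝ (Fin m))
    (Set.nonempty_coe_sort.mp inferInstance) (convex_stdSimplex ℝ (Fin n))
    (isCompact_stdSimplex ℝ (Fin n))
    (fun p => LinearMap.continuous_of_finiteDimensional _)
    (fun q => LinearMap.continuous_of_finiteDimensional _)
  simpa [Matrix.toLinearMap₂'_apply, mul_assoc, mul_comm, mul_left_comm] using h
end

section
/- (Expected time to find a marked element when sampling without replacement.) Let k ≥ 1, let S be a subset of {0,…,k−1} of size t with 1 ≤ t ≤ k, and pick a permutation σ of {0,…,k−1} uniformly at random (σ describes the order in which the k items are sampled without replacement). Let T(σ) be the least r ≥ 1 such that σ(r−1) ∈ S, i.e. the number of samples drawn until the first element of S is found. Then the expectation of T over the uniform distribution on permutations equals (k+1)/(t+1). -/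
/-- The first index `r` at which `f r ∈ S`, with junk value `0` if there is none. -/
noncomputable def firstHit {α : Type*} {k : ℕ} (S : Finset α) (f : Fin k → α) : ℕ :=
  sInf {r : ℕ | ∃ h : r < k, f ⟨r, h⟩ ∈ S}

theorem firstHit_eq_zero {α : Type*} {n : ℕ} {S : Finset α} {f : Fin (n + 1) → α}
    (h : f 0 ∈ S) : firstHit S f = 0 :=
  Nat.sInf_eq_zero.mpr (Or.inl ⟨n.succ_pos, h⟩)

theorem firstHit_eq_succ {α : Type*} {n : ℕ} {S : Finset α} {f : Fin (n + 1) → α}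
    (h0 : f 0 ∉ S) (h : ∃ i, f i ∈ S) :
    firstHit S f = firstHit S (fun i : Fin n => f i.succ) + 1 := by
  obtain ⟨i, hi⟩ := h
  have hne : {r : ℕ | ∃ h : r < n + 1, f ⟨r, h⟩ ∈ S}.Nonempty := ⟨i, i.2, hi⟩
  have hpos : 1 ≤ sInf {r : ℕ | ∃ h : r < n + 1, f ⟨r, h⟩ ∈ S} := by
    refine le_csInf hne ?_
    rintro (_ | r) ⟨hr, hmem⟩
    · exact absurd hmem h0
    · omega
  unfold firstHit
  rw [← Nat.sInf_add hpos]
  simp only [Nat.add_lt_add_iff_right, Fin.succ_mk]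

/-- The number of draws until `S` is hit, summed over all permutations, times `card S + 1`,
is `(k + 1)!`. -/
theorem card_add_one_mul_sum_firstHit {k : ℕ} (S : Finset (Fin k)) (hS : S.Nonempty) :
    (S.card + 1) * ∑ σ : Equiv.Perm (Fin k), (1 + firstHit S σ) = (k + 1).factorial := by
  induction k with
  | zero => exact hS.choose.elim0
  | succ n ih =>
    have hhit (p : Fin (n + 1)) (hp : p ∈ S) :
        ∑ e : Equiv.Perm (Fin n),
          (1 + firstHit S (Equiv.Perm.decomposeFin.symm (p, e))) = n.factorial := by
      have (e : Equiv.Perm (Fin n)) :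
          firstHit S (Equiv.Perm.decomposeFin.symm (p, e)) = 0 :=
        firstHit_eq_zero (by simpa using hp)
      simp [this, Fintype.card_perm]
    have hmiss (p : Fin (n + 1)) (hp : p ∉ S) :
        (S.card + 1) * ∑ e : Equiv.Perm (Fin n),
          (1 + firstHit S (Equiv.Perm.decomposeFin.symm (p, e))) =
        (S.card + 1) * n.factorial + (n + 1).factorial := by
      set g : Fin n → Fin (n + 1) := fun j => Equiv.swap 0 p j.succ with hg
      have hginj : Function.Injective g :=
        (Equiv.injective _).comp (Fin.succ_injective n)
      have hrange : (S : Set (Fin (n + 1))) ⊆ Set.range g := by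
        intro x hx
        have hxp : x ≠ p := fun h => hp (h ▸ hx)
        have h0 : Equiv.swap 0 p x ≠ 0 := fun h =>
          hxp (by simpa using congrArg (Equiv.swap 0 p) h)
        exact ⟨(Equiv.swap 0 p x).pred h0, by simp [hg]⟩
      set S' : Finset (Fin n) := S.preimage g hginj.injOn with hS'
      have hcard : S'.card = S.card := by
        rw [← Finset.card_map ⟨g, hginj⟩]
        congr 1
        ext x
        simp only [hS', Finset.mem_map, Finset.mem_preimage, Function.Embedding.coeFn_mk]
        constructor
        · rintro ⟨a, ha, rfl⟩
          exact ha
        · intro hx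
          obtain ⟨a, rfl⟩ := hrange hx
          exact ⟨a, hx, rfl⟩
      have hS'ne : S'.Nonempty := by
        rw [← Finset.card_pos, hcard]
        exact hS.card_pos
      have hstep (e : Equiv.Perm (Fin n)) :
          firstHit S (Equiv.Perm.decomposeFin.symm (p, e)) = 1 + firstHit S' e := by
        rw [firstHit_eq_succ (by simpa using hp)
          (hS.imp' (Equiv.Perm.decomposeFin.symm (p, e)).symm (by simp)), add_comm]
        simp only [Equiv.Perm.decomposeFin_symm_apply_succ]
        simp [firstHit, hS', hg]
      simp only [hstep]
      rw [Finset.sum_add_distrib, mul_add, ← hcard, ih S' hS'ne]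
      simp [Fintype.card_perm]
    rw [← Equiv.Perm.decomposeFin.symm.sum_comp, Fintype.sum_prod_type,
      ← Finset.sum_add_sum_compl S, Finset.sum_congr rfl hhit, mul_add, Finset.mul_sum Sᶜ,
      Finset.sum_congr rfl fun p hp => hmiss p (Finset.mem_compl.mp hp)]
    have hc : S.card + Sᶜ.card = n + 1 := by simp
    simp only [Finset.sum_const, smul_eq_mul, Nat.factorial_succ]
    generalize S.card = a at *
    generalize Sᶜ.card = b at *
    rw [← hc]
    ring

/-- **Expected time to find a marked element when sampling without
replacement.** Let `S ⊆ Fin k` have `card S = t ≥ 1` and sample the `k` items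
in the order given by a uniformly random permutation `σ` of `Fin k`.  The
number of samples until the first element of `S` is found is
`T σ = 1 + sInf {r | σ r ∈ S}` (0-indexed position of the first hit).  Its
expectation over the uniform distribution on permutations is `(k+1)/(t+1)`. -/
theorem expected_time_first_marked (k t : ℕ) (hk : 1 ≤ k)
    (S : Finset (Fin k)) (hS : S.card = t) (ht : 1 ≤ t) :
    (∑ σ : Equiv.Perm (Fin k),
        ((1 + sInf {r : ℕ | ∃ h : r < k, σ ⟨r, h⟩ ∈ S} : ℕ) : ℝ)) /
      (Nat.factorial k : ℝ) = (k + 1) / (t + 1) := by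
  subst hS
  have key := card_add_one_mul_sum_firstHit S (Finset.card_pos.mp ht)
  have key' := congrArg (Nat.cast : ℕ → ℝ) key
  rw [Nat.factorial_succ] at key'
  simp only [firstHit] at key'
  push_cast at key' ⊢
  rw [div_eq_div_iff (by positivity) (by positivity), mul_comm, ← key']
end

section
/- (Bipartite non-packing implies many edges.) Let E₁ and E₂ be edge sets of bipartite graphs on parts U and W each of size n, i.e. E₁, E₂ ⊆ (Fin n) × (Fin n). Say E₁ and E₂ pack if there exist permutations σ and τ of Fin n such that for every (u,w) ∈ E₁, (σ u, τ w) ∉ E₂. If E₁ and E₂ do not pack (for every pair of permutations σ, τ some edge of E₁ is mapped onto an edge of E₂), then |E₁| · |E₂| ≥ n². -/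
/-- **Bipartite non-packing implies many edges.** If for every pair of
permutations `σ, τ` of `Fin n` some edge of `E₁` is mapped onto an edge of
`E₂` (i.e. `E₁` and `E₂` do not pack), then `|E₁| * |E₂| ≥ n²`. -/
theorem bipartite_non_packing_many_edges (n : ℕ)
    (E₁ E₂ : Finset (Fin n × Fin n))
    (h : ¬ ∃ σ τ : Equiv.Perm (Fin n), ∀ e ∈ E₁, (σ e.1, τ e.2) ∉ E₂) :
    n ^ 2 ≤ E₁.card * E₂.card := by
  rcases Nat.eq_zero_or_pos n with rfl | hn
  · simp
  have : NeZero n := ⟨hn.ne'⟩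
  push Not at h
  -- Cyclic shifts suffice: an edge pair `(e, f)` determines the only shift taking `e` to `f`.
  have cover : (Finset.univ : Finset (Fin n × Fin n)) ⊆
      (E₁ ×ˢ E₂).image fun p => p.2 - p.1 := by
    rintro ⟨a, b⟩ -
    obtain ⟨e, he, hf⟩ := h (Equiv.addRight a) (Equiv.addRight b)
    exact Finset.mem_image.mpr ⟨(e, _), Finset.mk_mem_product he hf, by ext1 <;> simp⟩
  calc n ^ 2 = (Finset.univ : Finset (Fin n × Fin n)).card := by simp [sq]
    _ ≤ ((E₁ ×ˢ E₂).image fun p => p.2 - p.1).card := Finset.card_le_card cover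
    _ ≤ (E₁ ×ˢ E₂).card := Finset.card_image_le
    _ = E₁.card * E₂.card := Finset.card_product E₁ E₂
end

section
/- (Maximum-degree condition for graph packing.) Let G₁ and G₂ be simple graphs on the same vertex set V of size n. Say G₁ and G₂ pack if there exists a permutation σ of V such that for every edge {u,v} of G₁, {σ u, σ v} is not an edge of G₂. If G₁ and G₂ do not pack, then Δ(G₁) · Δ(G₂) ≥ n/2, where Δ denotes the maximum vertex degree. -/
namespace SimpleGraph

variable {V : Type*} [Fintype V] (G₁ G₂ : SimpleGraph V)
  [DecidableRel G₁.Adj] [DecidableRel G₂.Adj]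

/-- The ordered pairs adjacent in `G₁` whose images under `σ` are adjacent in `G₂`. -/
def packingConflicts (σ : Equiv.Perm V) : Finset (V × V) :=
  {p | G₁.Adj p.1 p.2 ∧ G₂.Adj (σ p.1) (σ p.2)}

variable {G₁ G₂}

theorem mem_packingConflicts {σ : Equiv.Perm V} {x y : V} :
    (x, y) ∈ packingConflicts G₁ G₂ σ ↔ G₁.Adj x y ∧ G₂.Adj (σ x) (σ y) := by
  simp [packingConflicts]

variable [DecidableEq V]

/-- If `n > 2 Δ(G₁) Δ(G₂)`, an endpoint `u` of a conflicting edge `uv` has a partner `w` such that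
exchanging the images of `u` and `w` creates no conflict at `u` or `w`. -/
theorem exists_packing_swap_partner
    (hn : 2 * (G₁.maxDegree * G₂.maxDegree) < Fintype.card V) {σ : Equiv.Perm V} {u v : V}
    (h₁ : G₁.Adj u v) (h₂ : G₂.Adj (σ u) (σ v)) :
    ∃ w, w ≠ v ∧ (∀ x, G₁.Adj u x → ¬ G₂.Adj (σ w) (σ x)) ∧
      ∀ x, G₁.Adj w x → ¬ G₂.Adj (σ u) (σ x) := by
  set A := (G₁.neighborFinset u).biUnion fun x => (G₂.neighborFinset (σ x)).image σ.symm with hA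
  set B := (G₂.neighborFinset (σ u)).biUnion fun y => G₁.neighborFinset (σ.symm y) with hB
  have memA : ∀ w, w ∈ A ↔ ∃ x, G₁.Adj u x ∧ G₂.Adj (σ x) (σ w) := by
    intro w
    simp [hA, Equiv.symm_apply_eq]
  have memB : ∀ w, w ∈ B ↔ ∃ x, G₂.Adj (σ u) (σ x) ∧ G₁.Adj x w := by
    intro w
    simp only [hB, Finset.mem_biUnion, mem_neighborFinset]
    exact ⟨fun ⟨y, hy, hw⟩ => ⟨σ.symm y, by simpa using hy, hw⟩,
      fun ⟨x, hx, hw⟩ => ⟨σ x, hx, by simpa using hw⟩⟩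
  have cardA : A.card ≤ G₁.maxDegree * G₂.maxDegree :=
    (Finset.card_biUnion_le_card_mul _ _ G₂.maxDegree fun x _ =>
      Finset.card_image_le.trans (G₂.degree_le_maxDegree _)).trans
      (Nat.mul_le_mul_right _ (G₁.degree_le_maxDegree u))
  have cardB : B.card ≤ G₁.maxDegree * G₂.maxDegree := by
    rw [mul_comm]
    exact (Finset.card_biUnion_le_card_mul _ _ G₁.maxDegree fun y _ =>
      G₁.degree_le_maxDegree _).trans
      (Nat.mul_le_mul_right _ (G₂.degree_le_maxDegree (σ u)))
  have cardInter : 0 < (A ∩ B).card := Finset.card_pos.mpr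
    ⟨u, Finset.mem_inter.mpr ⟨(memA u).mpr ⟨v, h₁, h₂.symm⟩, (memB u).mpr ⟨v, h₂, h₁.symm⟩⟩⟩
  have cardUnion := Finset.card_union_add_card_inter A B
  have cardInsert := Finset.card_insert_le v (A ∪ B)
  obtain ⟨w, hw⟩ : ∃ w, w ∉ insert v (A ∪ B) := by
    by_contra! hall
    have := Finset.card_univ (α := V)
    rw [← Finset.eq_univ_iff_forall.mpr hall] at this
    omega
  simp only [Finset.mem_insert, Finset.mem_union, not_or, memA, memB] at hw
  exact ⟨w, hw.1, fun x hx hwx => hw.2.1 ⟨x, hx, hwx.symm⟩,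
    fun x hx hux => hw.2.2 ⟨x, hux, hx.symm⟩⟩

/-- If `n > 2 Δ(G₁) Δ(G₂)`, a permutation with a conflict does not minimise the conflicts. -/
theorem exists_packingConflicts_ssubset
    (hn : 2 * (G₁.maxDegree * G₂.maxDegree) < Fintype.card V) {σ : Equiv.Perm V} {u v : V}
    (h₁ : G₁.Adj u v) (h₂ : G₂.Adj (σ u) (σ v)) :
    ∃ τ : Equiv.Perm V, packingConflicts G₁ G₂ τ ⊂ packingConflicts G₁ G₂ σ := by
  obtain ⟨w, hwv, hu, hw⟩ := exists_packing_swap_partner hn h₁ h₂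
  refine ⟨(Equiv.swap u w).trans σ, Finset.ssubset_iff_subset_ne.mpr ⟨?_, fun heq => ?_⟩⟩
  · rintro ⟨x, y⟩ hxy
    simp only [mem_packingConflicts, Equiv.trans_apply, Equiv.swap_apply_def] at hxy ⊢
    obtain ⟨hxy, hσ⟩ := hxy
    refine ⟨hxy, ?_⟩
    have := hxy.symm
    have := hσ.symm
    have := hxy.ne
    split_ifs at hσ <;> grind [G₂.adj_comm]
  · have huv : (u, v) ∈ packingConflicts G₁ G₂ σ := mem_packingConflicts.mpr ⟨h₁, h₂⟩
    rw [← heq] at huv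
    simp only [mem_packingConflicts, Equiv.trans_apply, Equiv.swap_apply_left,
      Equiv.swap_apply_of_ne_of_ne h₁.ne' hwv.symm] at huv
    exact hu v h₁ huv.2

end SimpleGraph

/-- **Maximum-degree condition for graph packing.** If two simple graphs
`G₁, G₂` on the same vertex set of size `n` do not pack (for every permutation
`σ` some edge of `G₁` is mapped onto an edge of `G₂`), then
`Δ(G₁) * Δ(G₂) ≥ n / 2`. -/
theorem maxDegree_non_packing (V : Type*) [Fintype V] [DecidableEq V] (n : ℕ)
    (hV : Fintype.card V = n) (G₁ G₂ : SimpleGraph V)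
    [DecidableRel G₁.Adj] [DecidableRel G₂.Adj]
    (h : ¬ ∃ σ : Equiv.Perm V, ∀ u v, G₁.Adj u v → ¬ G₂.Adj (σ u) (σ v)) :
    (n : ℝ) / 2 ≤ (G₁.maxDegree : ℝ) * (G₂.maxDegree : ℝ) := by
  subst hV
  by_contra hlt
  have hn : 2 * (G₁.maxDegree * G₂.maxDegree) < Fintype.card V := by
    have : (2 * (G₁.maxDegree * G₂.maxDegree) : ℝ) < Fintype.card V := by linarith
    exact_mod_cast this
  obtain ⟨σ, hσ⟩ := Finite.exists_min fun σ => (SimpleGraph.packingConflicts G₁ G₂ σ).card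
  refine h ⟨σ, fun u v h₁ h₂ => ?_⟩
  obtain ⟨τ, hτ⟩ := SimpleGraph.exists_packingConflicts_ssubset hn h₁ h₂
  exact (Finset.card_lt_card hτ).not_ge (hσ τ)
end

section
/- (Dirac-type condition for Hamiltonicity.) Let G be a simple graph on n vertices such that every vertex has degree strictly greater than n/2. Then G contains a Hamiltonian cycle. -/
namespace SimpleGraph

variable {V : Type*} {G : SimpleGraph V} {u v : V}

namespace Walk

/-- All neighbors of the start of a path of maximal length lie on the path. -/
lemma IsPath.mem_support_of_adj_of_maximal {p : G.Walk u v} (hp : p.IsPath)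
    (hmax : ∀ (u' v' : V) (p' : G.Walk u' v'), p'.IsPath → p'.length ≤ p.length)
    {w : V} (hw : G.Adj u w) : w ∈ p.support := by
  by_contra hws
  have := hmax _ _ _ (hp.cons (h := hw.symm) hws)
  simp at this

/-- The neighbors of the start of a path of maximal length are counted by the positions
they follow on the path. -/
lemma IsPath.degree_le_card_filter_adj_getVert_succ [Fintype V] [DecidableEq V]
    [DecidableRel G.Adj] {p : G.Walk u v} (hp : p.IsPath)
    (hmax : ∀ (u' v' : V) (p' : G.Walk u' v'), p'.IsPath → p'.length ≤ p.length) :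
    G.degree u ≤ ((Finset.range p.length).filter fun i ↦ G.Adj u (p.getVert (i + 1))).card := by
  rw [← G.card_neighborFinset_eq_degree u]
  refine (Finset.card_le_card fun w hw ↦ ?_).trans
    (Finset.card_image_le (f := fun i ↦ p.getVert (i + 1)))
  rw [mem_neighborFinset] at hw
  obtain ⟨k, rfl, hk⟩ := mem_support_iff_exists_getVert.mp
    (hp.mem_support_of_adj_of_maximal hmax hw)
  rcases k with _ | k
  · simp at hw
  · exact Finset.mem_image.mpr ⟨k, by simpa using ⟨by lia, hw⟩, rfl⟩

/-- The neighbors of the end of a path of maximal length are counted by their positions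
on the path. -/
lemma IsPath.degree_le_card_filter_getVert_adj [Fintype V] [DecidableEq V]
    [DecidableRel G.Adj] {p : G.Walk u v} (hp : p.IsPath)
    (hmax : ∀ (u' v' : V) (p' : G.Walk u' v'), p'.IsPath → p'.length ≤ p.length) :
    G.degree v ≤ ((Finset.range p.length).filter fun i ↦ G.Adj (p.getVert i) v).card := by
  rw [← G.card_neighborFinset_eq_degree v]
  refine (Finset.card_le_card fun w hw ↦ ?_).trans (Finset.card_image_le (f := p.getVert))
  rw [mem_neighborFinset] at hw
  have hws : w ∈ p.support := by
    simpa using hp.reverse.mem_support_of_adj_of_maximal (by simpa using hmax) hw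
  obtain ⟨k, rfl, hk⟩ := mem_support_iff_exists_getVert.mp hws
  rcases hk.lt_or_eq with hk | rfl
  · exact Finset.mem_image.mpr ⟨k, by simpa using ⟨hk, hw.symm⟩, rfl⟩
  · simp at hw

/-- If the start of a path is adjacent to its `(i + 1)`-st vertex and the end is adjacent to its
`i`-th vertex, then the vertices of the path can be rearranged into a cycle. -/
lemma IsPath.exists_isCycle_of_crossing {p : G.Walk u v} (hp : p.IsPath) {i : ℕ}
    (hi : i < p.length) (hu : G.Adj u (p.getVert (i + 1))) (hv : G.Adj (p.getVert i) v)
    (hlen : 2 ≤ p.length) : ∃ c : G.Walk u u, c.IsCycle ∧ c.length = p.length + 1 := by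
  let q := (p.drop (i + 1)).append (cons hv.symm (p.take i).reverse)
  have hql : q.length = p.length := by
    simp only [q, length_append, length_cons, length_reverse, drop_length, take_length]
    lia
  have hq : q.IsPath := by
    rw [isPath_def]
    have hperm : q.support.Perm p.support := by
      simp only [q, support_append, support_cons, List.tail_cons, support_reverse, support_take,
        drop_support_eq_support_drop_min, min_eq_left (Nat.succ_le_of_lt hi)]
      refine ((List.reverse_perm _).append_left _).trans (List.perm_append_comm.trans ?_)
      rw [List.take_append_drop]
    exact hperm.nodup_iff.mpr hp.support_nodup
  refine ⟨cons hu q, isCycle_iff_isPath_tail_and_le_length.mpr ⟨by simpa using hq, ?_⟩, ?_⟩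
  · simp only [length_cons, hql]; lia
  · simp [hql]

/-- A cycle with a neighbor outside of it gives a path with as many edges. -/
lemma IsCycle.exists_isPath_of_adj [DecidableEq V] {c : G.Walk u u} (hc : c.IsCycle) {x w : V}
    (hx : x ∈ c.support) (hw : w ∉ c.support) (hxw : G.Adj x w) :
    ∃ (y : V) (q : G.Walk y w), q.IsPath ∧ q.length = c.length := by
  have hr := hc.rotate hx
  have hws : w ∉ (c.rotate x hx).tail.support := by
    rw [support_tail_of_not_nil _ hr.not_nil]
    exact fun h ↦ hw ((mem_support_rotate_iff c x hx).mp (List.mem_of_mem_tail h))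
  refine ⟨_, (c.rotate x hx).tail.concat hxw, hr.isPath_tail.concat hws hxw, ?_⟩
  rw [length_concat, length_tail_add_one hr.not_nil, length_rotate]

end Walk

/-- **Dirac's theorem** for graphs whose degrees are all more than half the number of vertices. -/
theorem exists_isHamiltonianCycle_of_card_lt_two_mul_degree [Fintype V] [DecidableEq V]
    [Nonempty V] [DecidableRel G.Adj] (hdeg : ∀ v, Fintype.card V < 2 * G.degree v) :
    ∃ (v : V) (p : G.Walk v v), p.IsHamiltonianCycle := by
  obtain ⟨u, v, p, hp, hmax⟩ := Walk.exists_isPath_forall_isPath_length_le_length G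
  have hS := hp.degree_le_card_filter_adj_getVert_succ hmax
  have hT := hp.degree_le_card_filter_getVert_adj hmax
  have hu := hdeg u
  have hv := hdeg v
  have hlt := hp.length_lt
  have hle : G.degree u ≤ p.length := hS.trans ((Finset.card_filter_le _ _).trans (by simp))
  obtain ⟨i, hi⟩ := Finset.inter_nonempty_of_card_lt_card_add_card
    (Finset.filter_subset (fun i ↦ G.Adj u (p.getVert (i + 1))) (Finset.range p.length))
    (Finset.filter_subset (fun i ↦ G.Adj (p.getVert i) v) (Finset.range p.length))
    (by rw [Finset.card_range]; lia)
  simp only [Finset.mem_inter, Finset.mem_filter, Finset.mem_range] at hi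
  obtain ⟨c, hc, hcl⟩ := hp.exists_isCycle_of_crossing hi.1.1 hi.1.2 hi.2.2 (by lia)
  refine ⟨u, c, hc, hc.isPath_tail.isHamiltonian_of_mem fun w ↦ ?_⟩
  by_contra hw
  have hcard : c.tail.support.toFinset.card = p.length + 1 := by
    rw [List.toFinset_card_of_nodup hc.isPath_tail.support_nodup, Walk.length_support,
      Walk.length_tail_add_one hc.not_nil, hcl]
  obtain ⟨x, hx⟩ := Finset.inter_nonempty_of_card_lt_card_add_card
    (Finset.subset_univ c.tail.support.toFinset) (Finset.subset_univ (G.neighborFinset w))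
    (by rw [hcard, card_neighborFinset_eq_degree, Finset.card_univ]; have := hdeg w; lia)
  simp only [Finset.mem_inter, List.mem_toFinset, mem_neighborFinset] at hx
  have hxc : x ∈ c.support := by
    rw [← Walk.cons_support_tail hc.not_nil]
    exact List.mem_cons_of_mem _ hx.1
  have hwc : w ∉ c.support := by
    rw [← Walk.cons_support_tail hc.not_nil, List.mem_cons]
    rintro (rfl | h)
    · exact hw c.tail.end_mem_support
    · exact hw h
  obtain ⟨y, q, hq, hql⟩ := hc.exists_isPath_of_adj hxc hwc hx.2.symm
  have := hmax _ _ q hq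
  lia

end SimpleGraph

/-- **Dirac-type condition for Hamiltonicity.** If every vertex of a simple
graph `G` on `n` vertices has degree strictly greater than `n / 2`, then `G`
contains a Hamiltonian cycle. -/
theorem dirac_hamiltonian (V : Type*) [Fintype V] [DecidableEq V] [Nonempty V]
    (n : ℕ) (hV : Fintype.card V = n) (G : SimpleGraph V) [DecidableRel G.Adj]
    (hdeg : ∀ v : V, (n : ℝ) / 2 < (G.degree v : ℝ)) :
    ∃ (v : V) (p : G.Walk v v), p.IsHamiltonianCycle := by
  refine G.exists_isHamiltonianCycle_of_card_lt_two_mul_degree fun v ↦ ?_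
  have h : (n : ℝ) < 2 * G.degree v := by linarith [hdeg v]
  rw [hV]
  exact_mod_cast h
end
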